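/- arXiv:2305.10587 — 2 statements merged into one kernel-verified Lean document; each statement's English description precedes it below -/
import Mathlib

section
/- (Quantum bound of the Svetlichny inequality with dishonest parties) Let N ≥ 2, 2 ≤ k ≤ N. Let A_0^{(i)}, A_1^{(i)} be binary observables on ℂ^{d_i} for i = 1,…,k−1 and M_v binary observables on ℂ^{d_D} for v ∈ {0,1}^{N−k+1}. Then the operator 2^{N−1}√2·I − Ŝ_N^+ is positive semidefinite; equivalently, for every unit vector ψ in the tensor product space, ⟨ψ, Ŝ_N^+ ψ⟩ ≤ 2^{N−1}√2. Hence the maximal quantum value of the N-partite Svetlichny expression, even allowing joint strategies of the grouped dishonest parties, is 2^{N−1}√2. -/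
open Matrix ComplexOrder

noncomputable section

/-- Hamming weight of a bit string. -/
def wt {n : ℕ} (x : Fin n → Fin 2) : ℕ := ∑ i, (x i : ℕ)

/-- The Svetlichny sign `(-1)^{w(x)(w(x)+1)/2}`. -/
def sgn {n : ℕ} (x : Fin n → Fin 2) : ℂ := (-1) ^ (wt x * (wt x + 1) / 2)

/-- The joint Hilbert-space index of `h` honest parties (local dimensions `d i`) and the
grouped dishonest parties (dimension `dD`). -/
abbrev FullIdx (h : ℕ) (d : Fin h → ℕ) (dD : ℕ) :=
  ((i : Fin h) → Fin (d i)) × Fin dD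

/-- The tensor-product observable
`A^{(1)}_{x_1} ⊗ ⋯ ⊗ A^{(k-1)}_{x_{k-1}} ⊗ M_{(x_k,…,x_N)}`, written entrywise; here
`h = k - 1` and the dishonest input strings have length `N - k + 1 = s + 1`. -/
def bigOp {h s : ℕ} {d : Fin h → ℕ} {dD : ℕ}
    (A : (i : Fin h) → Fin 2 → Matrix (Fin (d i)) (Fin (d i)) ℂ)
    (M : (Fin (s + 1) → Fin 2) → Matrix (Fin dD) (Fin dD) ℂ)
    (x : Fin (h + (s + 1)) → Fin 2) :
    Matrix (FullIdx h d dD) (FullIdx h d dD) ℂ :=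
  Matrix.of fun p q =>
    (∏ i, A i (x (Fin.castAdd (s + 1) i)) (p.1 i) (q.1 i)) *
      M (fun j => x (Fin.natAdd h j)) p.2 q.2

/-- The Svetlichny–Bell operator `Ŝ_N^+` with a grouped dishonest set (`N = h + (s+1)`). -/
def svetOp {h s : ℕ} {d : Fin h → ℕ} {dD : ℕ}
    (A : (i : Fin h) → Fin 2 → Matrix (Fin (d i)) (Fin (d i)) ℂ)
    (M : (Fin (s + 1) → Fin 2) → Matrix (Fin dD) (Fin dD) ℂ) :
    Matrix (FullIdx h d dD) (FullIdx h d dD) ℂ :=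
  ∑ x : Fin (h + (s + 1)) → Fin 2, sgn x • bigOp A M x

/-- The Kronecker product of a family of matrices with one further matrix. -/
def tensorOp {h : ℕ} {d : Fin h → ℕ} {dD : ℕ}
    (B : (i : Fin h) → Matrix (Fin (d i)) (Fin (d i)) ℂ) (C : Matrix (Fin dD) (Fin dD) ℂ) :
    Matrix (FullIdx h d dD) (FullIdx h d dD) ℂ :=
  Matrix.of fun p q => (∏ i, B i (p.1 i) (q.1 i)) * C p.2 q.2

lemma tensorOp_mul {h : ℕ} {d : Fin h → ℕ} {dD : ℕ}
    (B B' : (i : Fin h) → Matrix (Fin (d i)) (Fin (d i)) ℂ) (C C' : Matrix (Fin dD) (Fin dD) ℂ) :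
    tensorOp B C * tensorOp B' C' = tensorOp (fun i => B i * B' i) (C * C') := by
  ext p q
  simp only [tensorOp, Matrix.mul_apply, Matrix.of_apply, Fintype.sum_prod_type]
  rw [Finset.prod_univ_sum, Fintype.piFinset_univ, Finset.sum_mul]
  refine Finset.sum_congr rfl fun r _ => ?_
  rw [Finset.mul_sum]
  refine Finset.sum_congr rfl fun t _ => ?_
  rw [Finset.prod_mul_distrib]
  ring

lemma tensorOp_one {h : ℕ} {d : Fin h → ℕ} {dD : ℕ} :
    tensorOp (fun i : Fin h => (1 : Matrix (Fin (d i)) (Fin (d i)) ℂ))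
      (1 : Matrix (Fin dD) (Fin dD) ℂ) = 1 := by
  ext p q
  simp only [tensorOp, Matrix.of_apply, Matrix.one_apply, Finset.prod_ite_zero,
    Finset.prod_const_one, Finset.mem_univ, true_imp_iff, Prod.ext_iff, funext_iff]
  split_ifs <;> simp_all

lemma tensorOp_isHermitian {h : ℕ} {d : Fin h → ℕ} {dD : ℕ}
    {B : (i : Fin h) → Matrix (Fin (d i)) (Fin (d i)) ℂ} {C : Matrix (Fin dD) (Fin dD) ℂ}
    (hB : ∀ i, (B i).IsHermitian) (hC : C.IsHermitian) : (tensorOp B C).IsHermitian := by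
  ext p q
  simp only [tensorOp, Matrix.conjTranspose_apply, Matrix.of_apply, star_mul', star_prod,
    (hB _).apply, hC.apply]

/-- Sum-of-squares certificate: if `X₀, X₁` are binary observables commuting with the binary
observables `U y`, and the signs `ε y` are balanced, then
`∑ y, c y • (X₀ + ε y • X₁) * U y` is at most `√2 · |ι|`. -/
lemma posSemidef_sub_sum_sign_smul {ι n : Type*} [Fintype ι] [Fintype n] [DecidableEq n]
    {X₀ X₁ : Matrix n n ℂ} {U : ι → Matrix n n ℂ} {c ε : ι → ℂ}
    (hX₀ : X₀.IsHermitian) (hX₁ : X₁.IsHermitian) (hU : ∀ y, (U y).IsHermitian)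
    (hX₀sq : X₀ * X₀ = 1) (hX₁sq : X₁ * X₁ = 1) (hUsq : ∀ y, U y * U y = 1)
    (hcomm₀ : ∀ y, U y * X₀ = X₀ * U y) (hcomm₁ : ∀ y, U y * X₁ = X₁ * U y)
    (hc : ∀ y, c y = 1 ∨ c y = -1) (hε : ∀ y, ε y = 1 ∨ ε y = -1) (hε0 : ∑ y, ε y = 0) :
    (((Fintype.card ι * Real.sqrt 2 : ℝ) : ℂ) • (1 : Matrix n n ℂ) -
      ∑ y, c y • ((X₀ + ε y • X₁) * U y)).PosSemidef := by
  have h2 : ((Real.sqrt 2 : ℝ) : ℂ) * ((Real.sqrt 2 : ℝ) : ℂ) = 2 := by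
    rw [← Complex.ofReal_mul, Real.mul_self_sqrt (by norm_num)]; norm_num
  set r : ℂ := ((Real.sqrt 2 : ℝ) : ℂ) with hr
  have hrpos : (0 : ℂ) ≤ r / 4 := by
    have : r / 4 = ((Real.sqrt 2 / 4 : ℝ) : ℂ) := by rw [hr]; push_cast; rfl
    rw [this]
    exact Complex.zero_le_real.mpr (by positivity)
  have hstar {z : ℂ} (hz : z = 1 ∨ z = -1) : star z = z := by
    rcases hz with rfl | rfl <;> simp
  have hsq {z : ℂ} (hz : z = 1 ∨ z = -1) : z * z = 1 := by
    rcases hz with rfl | rfl <;> simp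
  have hterm (y : ι) :
      (X₀ + ε y • X₁ - (r * c y) • U y)ᴴ * (X₀ + ε y • X₁ - (r * c y) • U y) =
        (4 : ℂ) • (1 : Matrix n n ℂ) + ε y • (X₀ * X₁ + X₁ * X₀) -
          (2 * r) • c y • ((X₀ + ε y • X₁) * U y) := by
    have hH : (X₀ + ε y • X₁ - (r * c y) • U y)ᴴ = X₀ + ε y • X₁ - (r * c y) • U y := by
      have hrs : star r = r := by rw [hr]; exact Complex.conj_ofReal _
      simp only [Matrix.conjTranspose_sub, Matrix.conjTranspose_add, Matrix.conjTranspose_smul,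
        hX₀.eq, hX₁.eq, (hU y).eq, star_mul', hstar (hc y), hstar (hε y), hrs]
    have hrc : r * c y * (r * c y) = 2 := by
      rw [mul_mul_mul_comm, h2, hsq (hc y), mul_one]
    rw [hH]
    simp only [sub_mul, mul_sub, add_mul, mul_add, Matrix.smul_mul, Matrix.mul_smul, hX₀sq, hX₁sq,
      hUsq, hcomm₀, hcomm₁, smul_smul, hsq (hε y), hrc, smul_add]
    module
  have hsum : ((Fintype.card ι * Real.sqrt 2 : ℝ) : ℂ) • (1 : Matrix n n ℂ) -
      ∑ y, c y • ((X₀ + ε y • X₁) * U y) = (r / 4) • ∑ y,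
        (X₀ + ε y • X₁ - (r * c y) • U y)ᴴ * (X₀ + ε y • X₁ - (r * c y) • U y) := by
    simp only [hterm, Finset.sum_sub_distrib, Finset.sum_add_distrib, ← Finset.sum_smul, hε0,
      zero_smul, add_zero, ← Finset.smul_sum, Finset.sum_const, Finset.card_univ, smul_sub]
    rw [smul_smul (r / 4) (2 * r), show r / 4 * (2 * r) = 1 by linear_combination h2 / 2,
      one_smul, ← Nat.cast_smul_eq_nsmul ℂ, smul_smul]
    congr 2
    rw [hr, smul_eq_mul]; push_cast; ring
  rw [hsum]
  exact (Matrix.posSemidef_sum _ fun y _ => Matrix.posSemidef_conjTranspose_mul_self _).smul hrpos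

lemma sum_update_bit {n : ℕ} {E : Type*} [AddCommMonoid E] (p : Fin n)
    (f : (Fin n → Fin 2) → E) :
    ∑ x, (f (Function.update x p 0) + f (Function.update x p 1)) = 2 • ∑ x, f x := by
  have hflip : Function.Involutive fun x : Fin n → Fin 2 => Function.update x p (1 - x p) := by
    intro x
    ext i
    by_cases hi : i = p
    · subst hi; simp
    · simp [hi]
  rw [two_nsmul]
  nth_rewrite 2 [← Equiv.sum_comp hflip.toPerm f]
  rw [← Finset.sum_add_distrib]
  refine Finset.sum_congr rfl fun x _ => ?_
  simp only [Function.Involutive.coe_toPerm]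
  rcases Fin.exists_fin_two.mp ⟨x p, rfl⟩ with h0 | h0
  · rw [← h0, Function.update_eq_self, h0, sub_zero]
  · rw [← h0, Function.update_eq_self, h0, sub_self, add_comm]

lemma wt_update {n : ℕ} (x : Fin n → Fin 2) (p : Fin n) (b : Fin 2) :
    wt (Function.update x p b) = b + wt (Function.update x p 0) := by
  have (a : Fin 2) : wt (Function.update x p a) = a + ∑ i ∈ Finset.univ.erase p, (x i : ℕ) := by
    rw [wt, ← Finset.add_sum_erase _ _ (Finset.mem_univ p)]
    congr 1
    · simp
    · exact Finset.sum_congr rfl fun i hi => by simp [Finset.ne_of_mem_erase hi]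
  rw [this b, this 0]; simp

lemma sgn_update_one {n : ℕ} (x : Fin n → Fin 2) (p : Fin n) :
    sgn (Function.update x p 1) =
      sgn (Function.update x p 0) * (-1) ^ (wt (Function.update x p 0) + 1) := by
  rw [sgn, sgn, wt_update x p 1, ← pow_add]
  congr 1
  set w := wt (Function.update x p 0)
  have : (1 + w) * (1 + w + 1) = w * (w + 1) + (w + 1) * 2 := by ring
  simp only [Fin.val_one, this]
  omega

lemma sum_neg_one_pow_wt_update {n : ℕ} {p q : Fin n} (hpq : q ≠ p) :
    ∑ x : Fin n → Fin 2, (-1 : ℂ) ^ (wt (Function.update x p 0) + 1) = 0 := by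
  have h := sum_update_bit q fun x => (-1 : ℂ) ^ (wt (Function.update x p 0) + 1)
  have hz (x : Fin n → Fin 2) :
      (-1 : ℂ) ^ (wt (Function.update (Function.update x q 0) p 0) + 1) +
        (-1 : ℂ) ^ (wt (Function.update (Function.update x q 1) p 0) + 1) = 0 := by
    rw [Function.update_comm hpq 0, Function.update_comm hpq 1, wt_update _ q 1]
    simp only [Fin.val_one, pow_add]
    ring
  simp only [hz, Finset.sum_const_zero] at h
  simpa using h.symm

/-- Quantum bound of the Svetlichny inequality with dishonest parties:
`2^{N-1}√2·I − Ŝ_N^+` is positive semidefinite, equivalently every unit state satisfies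
`⟨ψ, Ŝ_N^+ ψ⟩ ≤ 2^{N-1}√2`. Here `N = h + (s+1)` with `h = k - 1 ≥ 1` honest parties. -/
theorem stmt_9 (h s : ℕ) (hh : 1 ≤ h) (d : Fin h → ℕ) (dD : ℕ)
    (A : (i : Fin h) → Fin 2 → Matrix (Fin (d i)) (Fin (d i)) ℂ)
    (M : (Fin (s + 1) → Fin 2) → Matrix (Fin dD) (Fin dD) ℂ)
    (hAherm : ∀ i b, (A i b).IsHermitian) (hAsq : ∀ i b, A i b * A i b = 1)
    (hMherm : ∀ v, (M v).IsHermitian) (hMsq : ∀ v, M v * M v = 1) :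
    (((2 ^ (h + s) * Real.sqrt 2 : ℝ) : ℂ) •
        (1 : Matrix (FullIdx h d dD) (FullIdx h d dD) ℂ) - svetOp A M).PosSemidef ∧
      ∀ ψ : FullIdx h d dD → ℂ, (∑ p, ‖ψ p‖ ^ 2) = 1 →
        (∑ p, (starRingEnd ℂ) (ψ p) * (svetOp A M).mulVec ψ p).re ≤
          2 ^ (h + s) * Real.sqrt 2 := by
  have hpsd : (((2 ^ (h + s) * Real.sqrt 2 : ℝ) : ℂ) •
      (1 : Matrix (FullIdx h d dD) (FullIdx h d dD) ℂ) - svetOp A M).PosSemidef := by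
    let i₀ : Fin h := ⟨0, hh⟩
    let p : Fin (h + (s + 1)) := Fin.castAdd (s + 1) i₀
    let X (b : Fin 2) : Matrix (FullIdx h d dD) (FullIdx h d dD) ℂ :=
      tensorOp (fun i => if i = i₀ then A i b else 1) 1
    let U (x : Fin (h + (s + 1)) → Fin 2) : Matrix (FullIdx h d dD) (FullIdx h d dD) ℂ :=
      tensorOp (fun i => if i = i₀ then 1 else A i (x (Fin.castAdd (s + 1) i)))
        (M fun j => x (Fin.natAdd h j))
    have hX (b : Fin 2) : (X b).IsHermitian :=
      tensorOp_isHermitian (fun i => by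
        split_ifs; exacts [hAherm i b, Matrix.isHermitian_one]) Matrix.isHermitian_one
    have hXsq (b : Fin 2) : X b * X b = 1 := by
      simp only [X, tensorOp_mul, mul_one]
      rw [← tensorOp_one]
      congr 1; funext i; split_ifs <;> simp [hAsq]
    have hU (x) : (U x).IsHermitian :=
      tensorOp_isHermitian (fun i => by
        split_ifs; exacts [Matrix.isHermitian_one, hAherm i _]) (hMherm _)
    have hUsq (x) : U x * U x = 1 := by
      simp only [U, tensorOp_mul, hMsq]
      rw [← tensorOp_one]
      congr 1; funext i; split_ifs <;> simp [hAsq]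
    have hcomm (b x) : U x * X b = X b * U x := by
      simp only [U, X, tensorOp_mul, mul_one, one_mul]
      congr 1; funext i; split_ifs <;> simp
    have hbig (b x) : bigOp A M (Function.update x p b) = X b * U x := by
      have hne (j : Fin (s + 1)) : Fin.natAdd h j ≠ p := by
        simp only [ne_eq, Fin.ext_iff, p, i₀, Fin.val_natAdd, Fin.val_castAdd]; omega
      simp only [U, X, tensorOp_mul, one_mul]
      change tensorOp _ _ = _
      congr 1
      · funext i
        by_cases hi : i = i₀
        · subst hi; simp [p]
        · have : Fin.castAdd (s + 1) i ≠ p := fun h' => hi (Fin.castAdd_injective _ _ h')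
          simp [hi, this]
      · simp [hne]
    have hS : svetOp A M = (2⁻¹ : ℂ) • ∑ x : Fin (h + (s + 1)) → Fin 2,
        sgn (Function.update x p 0) •
          ((X 0 + ((-1 : ℂ) ^ (wt (Function.update x p 0) + 1)) • X 1) * U x) := by
      have key := sum_update_bit p fun x => sgn x • bigOp A M x
      simp only [hbig, sgn_update_one] at key
      rw [svetOp, eq_inv_smul_iff₀ two_ne_zero, ← Nat.cast_ofNat, Nat.cast_smul_eq_nsmul ℂ, ← key]
      refine Finset.sum_congr rfl fun x _ => ?_
      rw [add_mul, smul_add, Matrix.smul_mul, smul_smul]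
    have hpq : Fin.natAdd h (0 : Fin (s + 1)) ≠ p := by
      simp only [ne_eq, Fin.ext_iff, p, i₀, Fin.val_natAdd, Fin.val_castAdd]; omega
    have main := (posSemidef_sub_sum_sign_smul (hX 0) (hX 1) hU (hXsq 0) (hXsq 1) hUsq
      (hcomm 0) (hcomm 1) (c := fun x => sgn (Function.update x p 0))
      (fun x => neg_one_pow_eq_or ℂ _) (fun x => neg_one_pow_eq_or ℂ _)
      (sum_neg_one_pow_wt_update hpq)).smul (show (0 : ℂ) ≤ 2⁻¹ by positivity)
    rw [smul_sub, ← hS, smul_smul] at main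
    convert main using 3
    simp only [Fintype.card_fun, Fintype.card_fin]
    push_cast
    ring
  refine ⟨hpsd, fun ψ hψ => ?_⟩
  have hq := (Complex.le_def.mp (hpsd.dotProduct_mulVec_nonneg ψ)).1
  have hn : star ψ ⬝ᵥ ψ = 1 := by
    have : star ψ ⬝ᵥ ψ = ((∑ p, ‖ψ p‖ ^ 2 : ℝ) : ℂ) := by
      simp only [dotProduct, Pi.star_apply, RCLike.star_def, Complex.conj_mul']
      push_cast; rfl
    rw [this, hψ, Complex.ofReal_one]
  rw [Matrix.sub_mulVec, Matrix.smul_mulVec, Matrix.one_mulVec, dotProduct_sub, dotProduct_smul,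
    hn, smul_eq_mul, mul_one, Complex.sub_re, Complex.ofReal_re, Complex.zero_re] at hq
  exact sub_nonneg.mp hq
end
end

section
/- (Theorem 1: self-testing of the GHZ state with dishonest parties, state part) Let N ≥ 2, 2 ≤ k ≤ N. Let A_0^{(i)}, A_1^{(i)} be binary observables on ℂ^{d_i} for i = 1,…,k−1, let M_v be a binary observable on ℂ^{d_D} for each v ∈ {0,1}^{N−k+1}, and let ψ be a unit vector in ℂ^{d_1}⊗…⊗ℂ^{d_{k−1}}⊗ℂ^{d_D} such that ⟨ψ, Ŝ_N^+ ψ⟩ = 2^{N−1}√2, where Ŝ_N^+ = Σ_{x ∈ {0,1}^N} (−1)^{w(x)(w(x)+1)/2} A_{x_1}^{(1)}⊗…⊗A_{x_{k−1}}^{(k−1)}⊗M_{(x_k,…,x_N)}. Then there exist natural numbers m_1,…,m_{k−1}, m_D, linear isometries V_i : ℂ^{d_i} → ℂ² ⊗ ℂ^{m_i} for i = 1,…,k−1 and V_D : ℂ^{d_D} → ℂ² ⊗ ℂ^{m_D}, and a unit vector ζ ∈ ℂ^{m_1}⊗…⊗ℂ^{m_{k−1}}⊗ℂ^{m_D} such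 that, under the canonical reordering of tensor factors, (V_1 ⊗ … ⊗ V_{k−1} ⊗ V_D) ψ = Φ^k ⊗ ζ, where Φ^k = (|0⟩^{⊗k} + |1⟩^{⊗k})/√2 is the k-partite GHZ state. -/
open Matrix

noncomputable section

/-- The GHZ state `(|0…0⟩ + |1…1⟩)/√2` on the qubits indexed by `α`. -/
def ghzVec {α : Type*} [Fintype α] [DecidableEq α] : (α → Fin 2) → ℂ :=
  fun b => ((if b = fun _ => 0 then 1 else 0) + (if b = fun _ => 1 then 1 else 0)) /
    (Real.sqrt 2 : ℂ)

section Preliminaries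

open Complex

section TensorOperator

variable {ι m : Type*} [Fintype ι] {n : ι → Type*}

/-- The tensor product `⨂ᵢ Xᵢ ⊗ Y`, written entrywise. -/
def tens (X : ∀ i, Matrix (n i) (n i) ℂ) (Y : Matrix m m ℂ) :
    Matrix ((∀ i, n i) × m) ((∀ i, n i) × m) ℂ :=
  Matrix.of fun p q => (∏ i, X i (p.1 i) (q.1 i)) * Y p.2 q.2

theorem tens_mul [DecidableEq ι] [Fintype m] [∀ i, Fintype (n i)]
    (X X' : ∀ i, Matrix (n i) (n i) ℂ) (Y Y' : Matrix m m ℂ) :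
    tens X Y * tens X' Y' = tens (fun i => X i * X' i) (Y * Y') := by
  ext p q
  simp only [tens, Matrix.mul_apply, Matrix.of_apply, Fintype.sum_prod_type]
  rw [Finset.prod_univ_sum, Fintype.piFinset_univ, Finset.sum_mul_sum]
  refine Finset.sum_congr rfl fun x _ => Finset.sum_congr rfl fun y _ => ?_
  rw [Finset.prod_mul_distrib]
  ring

theorem tens_one [DecidableEq m] [∀ i, DecidableEq (n i)] :
    tens (fun i => (1 : Matrix (n i) (n i) ℂ)) (1 : Matrix m m ℂ) = 1 := by
  ext p q
  simp only [tens, Matrix.of_apply, Matrix.one_apply]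
  by_cases h : p = q
  · simp [h]
  · rw [if_neg h]
    by_cases h2 : p.2 = q.2
    · have h1 : p.1 ≠ q.1 := fun h1 => h (Prod.ext h1 h2)
      obtain ⟨i, hi⟩ := Function.ne_iff.mp h1
      rw [Finset.prod_eq_zero (Finset.mem_univ i) (if_neg hi), zero_mul]
    · simp [h2]

theorem tens_conjTranspose (X : ∀ i, Matrix (n i) (n i) ℂ) (Y : Matrix m m ℂ) :
    (tens X Y)ᴴ = tens (fun i => (X i)ᴴ) Yᴴ := by
  ext p q
  simp [tens, Matrix.conjTranspose_apply]

theorem tens_sum [DecidableEq ι] {κ : Type*} [Fintype κ] (X : ∀ i, κ → Matrix (n i) (n i) ℂ)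
    (Y : Matrix m m ℂ) :
    tens (fun i => ∑ b, X i b) Y = ∑ u : ι → κ, tens (fun i => X i (u i)) Y := by
  ext p q
  simp only [tens, Matrix.sum_apply, Matrix.of_apply]
  rw [Finset.prod_univ_sum, Fintype.piFinset_univ, Finset.sum_mul]

theorem tens_smul (a : ι → ℂ) (b : ℂ) (X : ∀ i, Matrix (n i) (n i) ℂ) (Y : Matrix m m ℂ) :
    tens (fun i => a i • X i) (b • Y) = ((∏ i, a i) * b) • tens X Y := by
  ext p q
  simp only [tens, Matrix.smul_apply, Matrix.of_apply, smul_eq_mul, Finset.prod_mul_distrib]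
  ring

theorem tens_add_right (X : ∀ i, Matrix (n i) (n i) ℂ) (Y Y' : Matrix m m ℂ) :
    tens X (Y + Y') = tens X Y + tens X Y' := by
  ext p q
  simp [tens, mul_add]

theorem tens_smul_right (b : ℂ) (X : ∀ i, Matrix (n i) (n i) ℂ) (Y : Matrix m m ℂ) :
    tens X (b • Y) = b • tens X Y := by
  simpa using tens_smul (fun _ => 1) b X Y

theorem tens_mulSingle_apply [DecidableEq ι] [∀ i, DecidableEq (n i)] (i : ι)
    (X : Matrix (n i) (n i) ℂ) (Y : Matrix m m ℂ) (p q : (∀ i, n i) × m) :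
    tens (Pi.mulSingle i X) Y p q =
      X (p.1 i) (q.1 i) *
        ((∏ j ∈ Finset.univ.erase i, (1 : Matrix (n j) (n j) ℂ) (p.1 j) (q.1 j)) * Y p.2 q.2) := by
  rw [tens, Matrix.of_apply, ← Finset.mul_prod_erase _ _ (Finset.mem_univ i), Pi.mulSingle_eq_same,
    mul_assoc]
  congr 2
  refine Finset.prod_congr rfl fun j hj => ?_
  rw [Pi.mulSingle_eq_of_ne (Finset.ne_of_mem_erase hj)]

theorem tens_mulSingle_smul_one_sub [DecidableEq ι] [DecidableEq m] [∀ i, DecidableEq (n i)] (i : ι)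
    (a : ℂ) (X : Matrix (n i) (n i) ℂ) :
    tens (Pi.mulSingle i (a • 1 - X)) (1 : Matrix m m ℂ) = a • 1 - tens (Pi.mulSingle i X) 1 := by
  have h1 : (1 : Matrix ((∀ i, n i) × m) ((∀ i, n i) × m) ℂ) = tens (Pi.mulSingle i 1) 1 := by
    rw [Pi.mulSingle_one]
    exact tens_one.symm
  rw [h1]
  ext p q
  simp only [tens_mulSingle_apply, Matrix.sub_apply, Matrix.smul_apply, smul_eq_mul]
  ring

/-- A vector fixed by every local operator up to scalars is an eigenvector of their product. -/
theorem tens_mulVec_of_forall_local [DecidableEq ι] [Fintype m] [DecidableEq m]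
    [∀ i, Fintype (n i)] [∀ i, DecidableEq (n i)] (a : ι → ℂ) (X : ∀ i, Matrix (n i) (n i) ℂ)
    (φ : ((∀ i, n i) × m) → ℂ)
    (hφ : ∀ i, tens (Pi.mulSingle i (X i)) (1 : Matrix m m ℂ) *ᵥ φ = a i • φ) :
    tens X (1 : Matrix m m ℂ) *ᵥ φ = (∏ i, a i) • φ := by
  have key : ∀ S : Finset ι,
      tens (fun i => if i ∈ S then X i else 1) (1 : Matrix m m ℂ) *ᵥ φ = (∏ i ∈ S, a i) • φ := by
    intro S
    induction S using Finset.induction_on with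
    | empty => simp [tens_one]
    | insert j S hj ih =>
      have : tens (fun i => if i ∈ insert j S then X i else 1) (1 : Matrix m m ℂ) =
          tens (fun i => if i ∈ S then X i else 1) 1 * tens (Pi.mulSingle j (X j)) 1 := by
        rw [tens_mul, mul_one]
        congr 1
        funext i
        by_cases h : i = j
        · subst h; simp [hj]
        · simp [h]
      rw [this, ← Matrix.mulVec_mulVec, hφ, Matrix.mulVec_smul, ih, smul_smul,
        Finset.prod_insert hj]
  simpa using key Finset.univ

end TensorOperator

section Ladder

variable {m : Type*}

/-- The ladder operators `X - iY` (index `0`) and `X + iY` (index `1`). -/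
def ladder (X Y : Matrix m m ℂ) : Fin 2 → Matrix m m ℂ := ![X - I • Y, X + I • Y]

variable {X Y : Matrix m m ℂ}

theorem ladder_conjTranspose (hX : X.IsHermitian) (hY : Y.IsHermitian) (b : Fin 2) :
    (ladder X Y b)ᴴ = ladder X Y (1 - b) := by
  fin_cases b <;>
    simp [ladder, Matrix.conjTranspose_add, hX.eq, hY.eq, sub_eq_add_neg]

variable [Fintype m] [DecidableEq m]

theorem ladder_sq (hX : X * X = 1) (hY : Y * Y = 1) :
    ladder X Y 0 * ladder X Y 0 = -(ladder X Y 1 * ladder X Y 1) := by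
  simp only [ladder, Matrix.cons_val_zero, Matrix.cons_val_one]
  simp only [mul_add, add_mul, mul_sub, sub_mul, smul_mul_assoc, mul_smul_comm, hX, hY,
    smul_add, smul_sub, smul_smul, I_mul_I]
  module

theorem ladder_mul_add (hX : X * X = 1) (hY : Y * Y = 1) :
    ladder X Y 0 * ladder X Y 1 + ladder X Y 1 * ladder X Y 0 = (4 : ℂ) • 1 := by
  simp only [ladder, Matrix.cons_val_zero, Matrix.cons_val_one]
  simp only [mul_add, add_mul, mul_sub, sub_mul, smul_mul_assoc, mul_smul_comm, hX, hY,
    smul_add, smul_sub, smul_smul, I_mul_I]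
  module

theorem ladder_comm (hX : X * X = 1) (hY : Y * Y = 1) (b : Fin 2) :
    ladder X Y b * (ladder X Y b * ladder X Y (1 - b)) =
      ladder X Y (1 - b) * (ladder X Y b * ladder X Y b) := by
  have h := ladder_sq hX hY
  have h' : ladder X Y 1 * ladder X Y 1 = -(ladder X Y 0 * ladder X Y 0) := by rw [h, neg_neg]
  fin_cases b
  · simp only [Fin.zero_eta, sub_zero]
    rw [h, mul_neg, ← mul_assoc, ← mul_assoc, h, neg_mul]
  · simp only [Fin.mk_one, sub_self]
    rw [h', mul_neg, ← mul_assoc, ← mul_assoc, h', neg_mul]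

end Ladder

section NormSq

variable {J K : Type*} [Fintype J] [Fintype K]

/-- The squared Hermitian norm of a vector. -/
def nsq (v : J → ℂ) : ℝ := ∑ j, ‖v j‖ ^ 2

theorem nsq_nonneg (v : J → ℂ) : 0 ≤ nsq v := Finset.sum_nonneg fun _ _ => by positivity

theorem nsq_eq_zero {v : J → ℂ} (h : nsq v = 0) : v = 0 := by
  funext j
  have := (Finset.sum_eq_zero_iff_of_nonneg (fun i _ => by positivity)).1 h j (Finset.mem_univ j)
  simpa using this

theorem nsq_smul (z : ℂ) (v : J → ℂ) : nsq (z • v) = ‖z‖ ^ 2 * nsq v := by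
  simp [nsq, Finset.mul_sum, mul_pow]

theorem coe_nsq (v : J → ℂ) : (nsq v : ℂ) = star v ⬝ᵥ v := by
  simp [nsq, dotProduct, Complex.conj_mul']

theorem coe_nsq_mulVec (B : Matrix K J ℂ) (v : J → ℂ) :
    (nsq (B *ᵥ v) : ℂ) = star v ⬝ᵥ ((Bᴴ * B) *ᵥ v) := by
  rw [coe_nsq, Matrix.star_mulVec, ← Matrix.mulVec_mulVec, ← Matrix.dotProduct_mulVec]

theorem nsq_mulVec_of_isometry [DecidableEq J] {B : Matrix K J ℂ} (hB : Bᴴ * B = 1) (v : J → ℂ) :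
    nsq (B *ᵥ v) = nsq v := by
  have := coe_nsq_mulVec B v
  rw [hB, Matrix.one_mulVec, ← coe_nsq] at this
  exact_mod_cast this

end NormSq

section SvetlichnySign

theorem neg_one_pow_triangular (w : ℕ) :
    ((-1) ^ (w * (w + 1) / 2) : ℂ) = ((1 + I) * I ^ w + (1 - I) * (-I) ^ w) / 2 := by
  have hrec : ∀ w : ℕ, ((-1) ^ ((w + 2) * (w + 2 + 1) / 2) : ℂ) = -(-1) ^ (w * (w + 1) / 2) := by
    intro w
    have : (w + 2) * (w + 2 + 1) / 2 = w * (w + 1) / 2 + 2 * w + 3 := by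
      rw [show (w + 2) * (w + 2 + 1) = w * (w + 1) + 2 * (2 * w + 3) by ring]
      omega
    rw [this, pow_add, pow_add, pow_mul]
    norm_num
  induction w using Nat.twoStepInduction with
  | zero => norm_num
  | one =>
    norm_num
    linear_combination -I_mul_I
  | more w ih _ =>
    rw [hrec, ih, pow_add, pow_add, neg_sq, I_sq]
    ring

theorem wt_append {a b : ℕ} (u : Fin a → Fin 2) (v : Fin b → Fin 2) :
    wt (Fin.append u v) = wt u + wt v := by
  simp [wt, Fin.sum_univ_add]

theorem sum_neg_one_pow_wt (s : ℕ) :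
    ∑ v : Fin (s + 1) → Fin 2, (-1 : ℂ) ^ wt v = 0 := by
  simp only [wt, ← Finset.prod_pow_eq_pow_sum]
  have := Finset.prod_univ_sum (fun _ : Fin (s + 1) => (Finset.univ : Finset (Fin 2)))
    (fun _ b => (-1 : ℂ) ^ (b : ℕ))
  rw [Fintype.piFinset_univ] at this
  rw [← this]
  simp

end SvetlichnySign

section Svetlichny

variable {h s : ℕ} {d : Fin h → ℕ} {dD : ℕ}
  {A : (i : Fin h) → Fin 2 → Matrix (Fin (d i)) (Fin (d i)) ℂ}
  {M : (Fin (s + 1) → Fin 2) → Matrix (Fin dD) (Fin dD) ℂ}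

/-- The product of ladder operators of the honest parties selected by the string `p`. -/
def honest (dD : ℕ) (A : (i : Fin h) → Fin 2 → Matrix (Fin (d i)) (Fin (d i)) ℂ)
    (p : Fin h → Fin 2) : Matrix (FullIdx h d dD) (FullIdx h d dD) ℂ :=
  tens (fun i => ladder (A i 0) (A i 1) (p i)) 1

/-- The coefficient of a dishonest observable `M_v` with `wt v = w` in the Svetlichny operator. -/
def svetB (dD : ℕ) (A : (i : Fin h) → Fin 2 → Matrix (Fin (d i)) (Fin (d i)) ℂ) (w : ℕ) :
    Matrix (FullIdx h d dD) (FullIdx h d dD) ℂ :=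
  ((1 + I) * I ^ w / 2) • honest dD A 1 + ((1 - I) * (-I) ^ w / 2) • honest dD A 0

theorem honest_const (A : (i : Fin h) → Fin 2 → Matrix (Fin (d i)) (Fin (d i)) ℂ) (z : ℂ)
    (b : Fin 2) (hz : z = ![-I, I] b) :
    honest dD A (fun _ => b) =
      ∑ u : Fin h → Fin 2, z ^ wt u • tens (fun i => A i (u i)) 1 := by
  have hl : ∀ i, ladder (A i 0) (A i 1) b = ∑ c : Fin 2, z ^ (c : ℕ) • A i c := by
    intro i
    subst hz
    fin_cases b <;> simp [ladder, sub_eq_add_neg]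
  simp only [honest, hl]
  rw [tens_sum]
  refine Finset.sum_congr rfl fun u _ => ?_
  have := tens_smul (fun i => z ^ (u i : ℕ)) 1 (fun i => A i (u i)) (1 : Matrix (Fin dD) (Fin dD) ℂ)
  rw [one_smul, mul_one, Finset.prod_pow_eq_pow_sum] at this
  exact this

theorem svetOp_eq (A : (i : Fin h) → Fin 2 → Matrix (Fin (d i)) (Fin (d i)) ℂ)
    (M : (Fin (s + 1) → Fin 2) → Matrix (Fin dD) (Fin dD) ℂ) :
    svetOp A M = ∑ v, svetB dD A (wt v) * tens (fun _ => 1) (M v) := by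
  have hbig : ∀ (u : Fin h → Fin 2) (v : Fin (s + 1) → Fin 2),
      sgn (Fin.append u v) • bigOp A M (Fin.append u v) =
        ((1 + I) * I ^ wt v / 2 * I ^ wt u + (1 - I) * (-I) ^ wt v / 2 * (-I) ^ wt u) •
          (tens (fun i => A i (u i)) 1 * tens (fun _ => 1) (M v)) := by
    intro u v
    rw [tens_mul]
    simp only [mul_one, one_mul]
    have : bigOp A M (Fin.append u v) = tens (fun i => A i (u i)) (M v) := by
      ext p q
      simp [bigOp, tens]
    rw [this, sgn, neg_one_pow_triangular, wt_append]
    congr 1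
    ring
  rw [svetOp, ← (Fin.appendEquiv h (s + 1)).sum_comp, Fintype.sum_prod_type_right]
  refine Finset.sum_congr rfl fun v _ => ?_
  have h1 := honest_const (dD := dD) A I 1 rfl
  have h0 := honest_const (dD := dD) A (-I) 0 rfl
  change honest dD A 1 = _ at h1
  change honest dD A 0 = _ at h0
  rw [svetB, h1, h0, Finset.smul_sum, Finset.smul_sum, ← Finset.sum_add_distrib, Finset.sum_mul]
  refine Finset.sum_congr rfl fun u _ => ?_
  refine (hbig u v).trans ?_
  rw [smul_smul, smul_smul, ← add_smul, smul_mul_assoc]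

theorem commute_tens_one (X : ∀ i, Matrix (Fin (d i)) (Fin (d i)) ℂ)
    (Y : Matrix (Fin dD) (Fin dD) ℂ) :
    Commute (tens X 1) (tens (fun _ => 1) Y) := by
  simp [Commute, SemiconjBy, tens_mul]

theorem commute_svetB (w : ℕ) (Y : Matrix (Fin dD) (Fin dD) ℂ) :
    Commute (svetB dD A w) (tens (fun _ => 1) Y) :=
  ((commute_tens_one _ Y).smul_left _).add_left ((commute_tens_one _ Y).smul_left _)

theorem honest_conjTranspose (hA : ∀ i b, (A i b).IsHermitian) (p : Fin h → Fin 2) :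
    (honest dD A p)ᴴ = honest dD A (fun i => 1 - p i) := by
  simp only [honest, tens_conjTranspose, ladder_conjTranspose (hA _ 0) (hA _ 1),
    Matrix.conjTranspose_one]

theorem svetB_conjTranspose (hA : ∀ i b, (A i b).IsHermitian) (w : ℕ) :
    (svetB dD A w)ᴴ = svetB dD A w := by
  have h1 : (honest dD A 1)ᴴ = honest dD A 0 := by
    rw [honest_conjTranspose hA]; rfl
  have h0 : (honest dD A 0)ᴴ = honest dD A 1 := by
    rw [honest_conjTranspose hA]; rfl
  rw [svetB, Matrix.conjTranspose_add, Matrix.conjTranspose_smul, Matrix.conjTranspose_smul,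
    h1, h0, add_comm]
  simp [sub_eq_add_neg]

theorem svetB_mul_self (w : ℕ) :
    svetB dD A w * svetB dD A w =
      (1 / 2 : ℂ) • (honest dD A 1 * honest dD A 0 + honest dD A 0 * honest dD A 1) +
        (-1 : ℂ) ^ w • ((I / 2) •
          (honest dD A 1 * honest dD A 1 - honest dD A 0 * honest dD A 0)) := by
  have hw : I ^ w * I ^ w = (-1) ^ w := by rw [← mul_pow, I_mul_I]
  have hw' : (-I) ^ w * (-I) ^ w = (-1) ^ w := by rw [← mul_pow]; simp
  have hw'' : I ^ w * (-I) ^ w = 1 := by rw [← mul_pow]; simp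
  simp only [svetB, mul_add, add_mul, smul_mul_assoc, mul_smul_comm]
  match_scalars
  · linear_combination (1 + I) ^ 2 / 4 * hw + (-1) ^ w / 4 * I_sq
  · linear_combination (1 + I) * (1 - I) / 4 * hw'' - 1 / 4 * I_sq
  · linear_combination (1 + I) * (1 - I) / 4 * hw'' - 1 / 4 * I_sq
  · linear_combination (1 - I) ^ 2 / 4 * hw' + (-1) ^ w / 4 * I_sq

theorem sum_honest (hA : ∀ i b, (A i b).IsHermitian) (hA2 : ∀ i b, A i b * A i b = 1) :
    ∑ p, (honest dD A p)ᴴ * honest dD A p = (4 ^ h : ℂ) • 1 := by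
  simp only [honest_conjTranspose hA]
  simp only [honest, tens_mul, mul_one]
  rw [← tens_sum (fun i b => ladder (A i 0) (A i 1) (1 - b) * ladder (A i 0) (A i 1) b)]
  have : ∀ i, ∑ b, ladder (A i 0) (A i 1) (1 - b) * ladder (A i 0) (A i 1) b = (4 : ℂ) • 1 := by
    intro i
    rw [Fin.sum_univ_two, add_comm]
    exact ladder_mul_add (hA2 i 0) (hA2 i 1)
  simp only [this]
  have := tens_smul (fun _ : Fin h => (4 : ℂ)) 1 (fun i => (1 : Matrix (Fin (d i)) (Fin (d i)) ℂ))
    (1 : Matrix (Fin dD) (Fin dD) ℂ)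
  simpa [tens_one] using this

/-- The sum-of-squares identity behind the quantum bound on the Svetlichny operator. -/
theorem sum_sq_deviation (hA : ∀ i b, (A i b).IsHermitian) (hM : ∀ v, (M v).IsHermitian)
    (hM2 : ∀ v, M v * M v = 1) (k : ℝ) :
    ∑ v, (tens (fun _ => 1) (M v) - (k : ℂ) • svetB dD A (wt v))ᴴ *
        (tens (fun _ => 1) (M v) - (k : ℂ) • svetB dD A (wt v)) =
      (2 ^ (s + 1) : ℂ) • 1 +
        (k ^ 2 * 2 ^ s : ℂ) •
          (honest dD A 1 * honest dD A 0 + honest dD A 0 * honest dD A 1) -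
        (2 * k : ℂ) • svetOp A M := by
  have hterm : ∀ v, (tens (fun _ => 1) (M v) - (k : ℂ) • svetB dD A (wt v))ᴴ *
        (tens (fun _ => 1) (M v) - (k : ℂ) • svetB dD A (wt v)) =
      1 + (k ^ 2 : ℂ) • (svetB dD A (wt v) * svetB dD A (wt v)) -
        (2 * k : ℂ) • (svetB dD A (wt v) * tens (fun _ => 1) (M v)) := by
    intro v
    have hsq : tens (fun i => (1 : Matrix (Fin (d i)) (Fin (d i)) ℂ)) (M v) *
        tens (fun _ => 1) (M v) = 1 := by
      rw [tens_mul, hM2]; simp [tens_one]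
    rw [Matrix.conjTranspose_sub, Matrix.conjTranspose_smul, svetB_conjTranspose hA,
      tens_conjTranspose, (hM v).eq]
    simp only [Matrix.conjTranspose_one, RCLike.star_def, conj_ofReal]
    simp only [mul_sub, sub_mul, smul_mul_assoc, mul_smul_comm, hsq,
      ← (commute_svetB (A := A) (wt v) (M v)).eq]
    module
  simp only [hterm, svetB_mul_self]
  rw [Finset.sum_sub_distrib, ← Finset.smul_sum, ← svetOp_eq, Finset.sum_add_distrib,
    ← Finset.smul_sum, Finset.sum_add_distrib,
    ← Finset.sum_smul (s := Finset.univ) (f := fun v => (-1 : ℂ) ^ wt v), sum_neg_one_pow_wt]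
  simp only [Finset.sum_const, Finset.card_univ, Fintype.card_fun, Fintype.card_fin]
  rw [zero_smul, add_zero, ← Nat.cast_smul_eq_nsmul ℂ, ← Nat.cast_smul_eq_nsmul ℂ]
  push_cast
  module

/-- A maximally violating state is annihilated by the mixed products of ladder operators, and the
dishonest observables act on it through the operators of the honest parties. -/
theorem maximal_violation (hh : 1 ≤ h) (hA : ∀ i b, (A i b).IsHermitian)
    (hA2 : ∀ i b, A i b * A i b = 1) (hM : ∀ v, (M v).IsHermitian) (hM2 : ∀ v, M v * M v = 1)
    {ψ : FullIdx h d dD → ℂ} (hψ : nsq ψ = 1)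
    (hmax : star ψ ⬝ᵥ (svetOp A M *ᵥ ψ) = ((2 ^ (h + s) * √2 : ℝ) : ℂ)) :
    (∀ v, tens (fun _ => 1) (M v) *ᵥ ψ = ((√2 / 2 ^ h : ℝ) : ℂ) • svetB dD A (wt v) *ᵥ ψ) ∧
      ∀ p, p ≠ 0 → p ≠ 1 → honest dD A p *ᵥ ψ = 0 := by
  set k : ℝ := √2 / 2 ^ h with hk
  have hk2 : k ^ 2 * 4 ^ h = 2 := by
    rw [hk, div_pow, Real.sq_sqrt (by norm_num), ← pow_mul, mul_comm h 2, pow_mul]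
    norm_num
  have hk1 : k * (2 ^ (h + s) * √2) = 2 ^ (s + 1) := by
    rw [hk, pow_add, pow_add]
    field_simp
    rw [Real.sq_sqrt (by norm_num)]
  have h01 : (0 : Fin h → Fin 2) ≠ 1 := fun e => by simpa using congrFun e ⟨0, hh⟩
  set R : Finset (Fin h → Fin 2) := (Finset.univ.erase 0).erase 1
  have hF1 : (honest dD A 1)ᴴ = honest dD A 0 := honest_conjTranspose hA 1
  have hF0 : (honest dD A 0)ᴴ = honest dD A 1 := honest_conjTranspose hA 0
  have hsplit : (honest dD A 1 * honest dD A 0 + honest dD A 0 * honest dD A 1) +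
      ∑ p ∈ R, (honest dD A p)ᴴ * honest dD A p = (4 ^ h : ℂ) • 1 := by
    rw [← sum_honest hA hA2, ← Finset.add_sum_erase _ _ (Finset.mem_univ 0),
      ← Finset.add_sum_erase _ _ (Finset.mem_erase.2 ⟨h01.symm, Finset.mem_univ 1⟩), hF0, hF1,
      add_assoc]
  have hsum := sum_sq_deviation hA hM hM2 k
  rw [eq_sub_of_add_eq hsplit] at hsum
  have hq := congrArg (fun B => star ψ ⬝ᵥ (B *ᵥ ψ)) hsum
  simp only [Matrix.sub_mulVec, Matrix.add_mulVec, Matrix.smul_mulVec, Matrix.sum_mulVec,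
    Matrix.one_mulVec, dotProduct_sub, dotProduct_add, dotProduct_smul, dotProduct_sum, hmax,
    ← coe_nsq, hψ] at hq
  simp only [← coe_nsq_mulVec, smul_eq_mul] at hq
  have hkpos : 0 < k ^ 2 * 2 ^ s := by positivity
  have hR : 0 ≤ ∑ p ∈ R, nsq (honest dD A p *ᵥ ψ) := Finset.sum_nonneg fun _ _ => nsq_nonneg _
  have hD : 0 ≤ ∑ v, nsq ((tens (fun _ => 1) (M v) - (k : ℂ) • svetB dD A (wt v)) *ᵥ ψ) :=
    Finset.sum_nonneg fun _ _ => nsq_nonneg _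
  have hq' : ∑ v, nsq ((tens (fun _ => 1) (M v) - (k : ℂ) • svetB dD A (wt v)) *ᵥ ψ) =
      -(k ^ 2 * 2 ^ s * ∑ p ∈ R, nsq (honest dD A p *ᵥ ψ)) := by
    apply Complex.ofReal_injective
    have hk1' : (k : ℂ) * (2 ^ (h + s) * √2) = 2 ^ (s + 1) := mod_cast hk1
    have hk2' : (k : ℂ) ^ 2 * 4 ^ h = 2 := mod_cast hk2
    push_cast at hq ⊢
    rw [hq]
    linear_combination 2 ^ s * hk2' - 2 * hk1'
  have hRD := mul_nonneg hkpos.le hR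
  have hD0 := (Finset.sum_eq_zero_iff_of_nonneg fun _ _ => nsq_nonneg _).1
    (le_antisymm (by linarith) hD)
  have hR0 := (Finset.sum_eq_zero_iff_of_nonneg fun _ _ => nsq_nonneg _).1
    (le_antisymm (by nlinarith) hR)
  refine ⟨fun v => ?_, fun p hp0 hp1 => ?_⟩
  · have := nsq_eq_zero (hD0 v (Finset.mem_univ v))
    rwa [Matrix.sub_mulVec, Matrix.smul_mulVec, sub_eq_zero] at this
  · exact nsq_eq_zero (hR0 p (by simp [R, hp0, hp1]))

theorem dishonest_ladder_mulVec (M0 M1 : Matrix (Fin dD) (Fin dD) ℂ)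
    {ψ : FullIdx h d dD → ℂ} {k : ℂ}
    (h0 : tens (fun _ => 1) M0 *ᵥ ψ = k • svetB dD A 0 *ᵥ ψ)
    (h1 : tens (fun _ => 1) M1 *ᵥ ψ = k • svetB dD A 1 *ᵥ ψ) :
    tens (fun _ => 1) (ladder M0 M1 0) *ᵥ ψ = ((1 + I) * k) • honest dD A 1 *ᵥ ψ ∧
      tens (fun _ => 1) (ladder M0 M1 1) *ᵥ ψ = ((1 - I) * k) • honest dD A 0 *ᵥ ψ := by
  have hl : ladder M0 M1 0 = M0 + (-I) • M1 := by simp [ladder, sub_eq_add_neg]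
  have hr : ladder M0 M1 1 = M0 + I • M1 := by simp [ladder]
  rw [hl, hr]
  simp only [tens_add_right, tens_smul_right, Matrix.add_mulVec, Matrix.smul_mulVec, h0, h1, svetB,
    pow_zero, pow_one, mul_one]
  constructor
  · match_scalars
    · linear_combination (-(1 + I) / 2 * k) * I_sq
    · linear_combination ((1 - I) / 2 * k) * I_sq
  · match_scalars
    · linear_combination ((1 + I) / 2 * k) * I_sq
    · linear_combination (-(1 - I) / 2 * k) * I_sq

theorem honest_sq (hA2 : ∀ i b, A i b * A i b = 1) (p : Fin h → Fin 2) :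
    honest dD A p * honest dD A p =
      (∏ i, if p i = 0 then (-1 : ℂ) else 1) • (honest dD A 1 * honest dD A 1) := by
  have hl : ∀ i, ladder (A i 0) (A i 1) (p i) * ladder (A i 0) (A i 1) (p i) =
      (if p i = 0 then (-1 : ℂ) else 1) •
        (ladder (A i 0) (A i 1) 1 * ladder (A i 0) (A i 1) 1) := by
    intro i
    rcases Fin.exists_fin_two.1 ⟨p i, rfl⟩ with e | e
    · rw [e, ladder_sq (hA2 i 0) (hA2 i 1)]; simp
    · rw [e]; simp
  simp only [honest, tens_mul, mul_one, Pi.one_apply, hl]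
  simpa using tens_smul (fun i => if p i = 0 then (-1 : ℂ) else 1) 1
    (fun i => ladder (A i 0) (A i 1) 1 * ladder (A i 0) (A i 1) 1)
    (1 : Matrix (Fin dD) (Fin dD) ℂ)

theorem honest_sq_mulVec_eq_zero (hh : 1 ≤ h) (hA2 : ∀ i b, A i b * A i b = 1)
    {M0 M1 : Matrix (Fin dD) (Fin dD) ℂ} (hM0 : M0 * M0 = 1) (hM1 : M1 * M1 = 1)
    {ψ : FullIdx h d dD → ℂ} {k : ℂ} (hk : k ≠ 0)
    (hmix : ∀ p, p ≠ 0 → p ≠ 1 → honest dD A p *ᵥ ψ = 0)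
    (hlower : tens (fun _ => 1) (ladder M0 M1 0) *ᵥ ψ = ((1 + I) * k) • honest dD A 1 *ᵥ ψ)
    (hraise : tens (fun _ => 1) (ladder M0 M1 1) *ᵥ ψ = ((1 - I) * k) • honest dD A 0 *ᵥ ψ)
    (p : Fin h → Fin 2) :
    (honest dD A p * honest dD A p) *ᵥ ψ = 0 := by
  suffices h1 : (honest dD A 1 * honest dD A 1) *ᵥ ψ = 0 by
    rw [honest_sq hA2, Matrix.smul_mulVec, h1, smul_zero]
  obtain rfl | hh' := hh.eq_or_lt
  · have hD : ∀ (b : Fin 2) (q : Fin 1 → Fin 2) (z : ℂ),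
        tens (fun _ => 1) (ladder M0 M1 b) *ᵥ ψ = z • honest dD A q *ᵥ ψ →
        tens (fun _ => 1) (ladder M0 M1 b * ladder M0 M1 b) *ᵥ ψ =
          z ^ 2 • (honest dD A q * honest dD A q) *ᵥ ψ := by
      intro b q z e
      have hsq : tens (fun i => (1 : Matrix (Fin (d i)) (Fin (d i)) ℂ))
          (ladder M0 M1 b * ladder M0 M1 b) =
          tens (fun _ => 1) (ladder M0 M1 b) * tens (fun _ => 1) (ladder M0 M1 b) := by
        simp [tens_mul]
      rw [hsq, ← Matrix.mulVec_mulVec, e, Matrix.mulVec_smul, Matrix.mulVec_mulVec, honest,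
        ← (commute_tens_one _ _).eq, ← honest, ← Matrix.mulVec_mulVec, e, Matrix.mulVec_smul,
        smul_smul, Matrix.mulVec_mulVec, sq]
    have e0 := hD 0 1 _ hlower
    have e1 := hD 1 0 _ hraise
    have hneg : ladder M0 M1 0 * ladder M0 M1 0 =
        (-1 : ℂ) • (ladder M0 M1 1 * ladder M0 M1 1) := by
      rw [ladder_sq hM0 hM1, neg_one_smul]
    rw [hneg, tens_smul_right, Matrix.smul_mulVec, e1, honest_sq hA2 0, Matrix.smul_mulVec] at e0
    simp only [Pi.zero_apply, if_true, Finset.univ_unique, Finset.prod_singleton, smul_smul] at e0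
    rw [← sub_eq_zero, ← sub_smul] at e0
    refine (smul_eq_zero.1 e0).resolve_left ?_
    have : -1 * (((1 - I) * k) ^ 2 * -1) - ((1 + I) * k) ^ 2 = -4 * I * k ^ 2 := by ring
    rw [this]
    simp [hk]
  · set p : Fin h → Fin 2 := Pi.single ⟨0, hh⟩ 1
    have hz : honest dD A p *ᵥ ψ = 0 := by
      refine hmix p (fun e => ?_) (fun e => ?_)
      · simpa [p] using congrFun e ⟨0, hh⟩
      · simpa [p, Pi.single_apply] using congrFun e ⟨1, hh'⟩
    have hp := congrArg (· *ᵥ ψ) (honest_sq (dD := dD) hA2 p)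
    simp only [← Matrix.mulVec_mulVec, hz, Matrix.mulVec_zero, Matrix.smul_mulVec] at hp
    rw [← Matrix.mulVec_mulVec]
    refine (smul_eq_zero.1 hp.symm).resolve_left (Finset.prod_ne_zero_iff.2 fun i _ => ?_)
    split_ifs <;> simp

theorem local_lower_mulVec (hA2 : ∀ i b, A i b * A i b = 1) {ψ : FullIdx h d dD → ℂ}
    (hmix : ∀ p, p ≠ 0 → p ≠ 1 → honest dD A p *ᵥ ψ = 0)
    (hsq : ∀ p, (honest dD A p * honest dD A p) *ᵥ ψ = 0) (i : Fin h) :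
    tens (Pi.mulSingle i (ladder (A i 0) (A i 1) 0)) 1 *ᵥ
      ((honest dD A 0 * honest dD A 1) *ᵥ ψ) = 0 := by
  have key : tens (Pi.mulSingle i (ladder (A i 0) (A i 1) 0)) 1 *
        (honest dD A 0 * honest dD A 1) =
      tens (Pi.mulSingle i (ladder (A i 0) (A i 1) 1)) 1 *
        (honest dD A 0 * honest dD A (Function.update 1 i 0)) := by
    simp only [honest, tens_mul, mul_one]
    congr 1
    funext j
    by_cases hj : j = i
    · subst hj
      simpa using ladder_comm (hA2 j 0) (hA2 j 1) 0
    · simp [hj]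
  rw [Matrix.mulVec_mulVec, key, ← Matrix.mulVec_mulVec]
  by_cases h0 : Function.update (1 : Fin h → Fin 2) i 0 = 0
  · rw [h0, hsq, Matrix.mulVec_zero]
  · rw [← Matrix.mulVec_mulVec, hmix _ h0, Matrix.mulVec_zero, Matrix.mulVec_zero]
    intro e
    simpa using congrFun e i

theorem tens_flip_mulVec (hA2 : ∀ i b, A i b * A i b = 1) {ψ : FullIdx h d dD → ℂ}
    (hmix : ∀ p, p ≠ 0 → p ≠ 1 → honest dD A p *ᵥ ψ = 0)
    (hsq : ∀ p, (honest dD A p * honest dD A p) *ᵥ ψ = 0) :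
    (tens (fun i => A i 0) 1 * honest dD A 1) *ᵥ ((honest dD A 0 * honest dD A 1) *ᵥ ψ) =
      (2 ^ h : ℂ) • (honest dD A 0 * honest dD A 1) *ᵥ ψ := by
  have hlow := local_lower_mulVec hA2 hmix hsq
  generalize (honest dD A 0 * honest dD A 1) *ᵥ ψ = φ at hlow ⊢
  rw [honest.eq_def dD A 1, tens_mul, mul_one, tens_mulVec_of_forall_local (fun _ => 2)]
  · simp
  intro i
  have hX : A i 0 * ladder (A i 0) (A i 1) 1 =
      (2 : ℂ) • 1 - A i 0 * ladder (A i 0) (A i 1) 0 := by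
    simp only [ladder, Matrix.cons_val_zero, Matrix.cons_val_one, mul_add, mul_sub, hA2]
    module
  have hY : tens (n := fun j => Fin (d j)) (Pi.mulSingle i (A i 0 * ladder (A i 0) (A i 1) 0))
      (1 : Matrix (Fin dD) (Fin dD) ℂ) =
      tens (Pi.mulSingle i (A i 0)) 1 * tens (Pi.mulSingle i (ladder (A i 0) (A i 1) 0)) 1 := by
    rw [tens_mul, mul_one, Pi.mulSingle_mul]
    rfl
  have hZ : tens (n := fun j => Fin (d j)) (Pi.mulSingle i (A i 0 * ladder (A i 0) (A i 1) 1))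
      (1 : Matrix (Fin dD) (Fin dD) ℂ) =
      (2 : ℂ) • 1 - tens (Pi.mulSingle i (A i 0)) 1 *
        tens (Pi.mulSingle i (ladder (A i 0) (A i 1) 0)) 1 := by
    rw [hX, tens_mulSingle_smul_one_sub, hY]
  refine (congrArg (· *ᵥ _) hZ).trans ?_
  rw [Matrix.sub_mulVec, ← Matrix.mulVec_mulVec _ (tens _ _), hlow]
  simp [Matrix.smul_mulVec]

theorem nsq_ladder_mulVec (hh : 1 ≤ h) (hA : ∀ i b, (A i b).IsHermitian)
    (hA2 : ∀ i b, A i b * A i b = 1) {ψ : FullIdx h d dD → ℂ} (hψ : nsq ψ = 1)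
    (hmix : ∀ p, p ≠ 0 → p ≠ 1 → honest dD A p *ᵥ ψ = 0)
    (hsq : ∀ p, (honest dD A p * honest dD A p) *ᵥ ψ = 0) :
    nsq ((honest dD A 0 * honest dD A 1) *ᵥ ψ) + nsq ((honest dD A 1 * honest dD A 0) *ᵥ ψ) =
      16 ^ h := by
  have h01 : (0 : Fin h → Fin 2) ≠ 1 := fun e => by simpa using congrFun e ⟨0, hh⟩
  have hF1 : (honest dD A 1)ᴴ = honest dD A 0 := honest_conjTranspose hA 1
  have hF0 : (honest dD A 0)ᴴ = honest dD A 1 := honest_conjTranspose hA 0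
  set φ₀ := (honest dD A 0 * honest dD A 1) *ᵥ ψ with hφ₀
  set φ₁ := (honest dD A 1 * honest dD A 0) *ᵥ ψ with hφ₁
  have hadd : φ₁ + φ₀ = (4 ^ h : ℂ) • ψ := by
    have := congrArg (· *ᵥ ψ) (sum_honest (dD := dD) hA hA2)
    simp only [Matrix.sum_mulVec, Matrix.smul_mulVec, Matrix.one_mulVec] at this
    rw [Fintype.sum_eq_add 0 1 h01, hF0, hF1] at this
    · exact this
    · rintro p ⟨hp0, hp1⟩
      rw [← Matrix.mulVec_mulVec, hmix p hp0 hp1, Matrix.mulVec_zero]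
  have horth : star φ₀ ⬝ᵥ φ₁ = 0 := by
    have hcomm : honest dD A 1 * (honest dD A 1 * honest dD A 0) =
        honest dD A 0 * (honest dD A 1 * honest dD A 1) := by
      simp only [honest, tens_mul, mul_one]
      congr 1
      funext i
      simpa using ladder_comm (hA2 i 0) (hA2 i 1) 1
    rw [hφ₀, ← Matrix.mulVec_mulVec, Matrix.star_mulVec, hF0, ← Matrix.dotProduct_mulVec, hφ₁,
      Matrix.mulVec_mulVec, hcomm, ← Matrix.mulVec_mulVec, hsq, Matrix.mulVec_zero,
      dotProduct_zero]
  have horth' : star φ₁ ⬝ᵥ φ₀ = 0 := by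
    rw [Matrix.star_dotProduct, horth, star_zero]
  apply Complex.ofReal_injective
  have hN := coe_nsq ((4 ^ h : ℂ) • ψ)
  rw [← hadd, star_add, add_dotProduct, dotProduct_add, dotProduct_add, horth, horth', ← coe_nsq,
    ← coe_nsq, hadd] at hN
  have h4 : nsq ((4 ^ h : ℂ) • ψ) = 16 ^ h := by
    have : ∀ j, ‖((4 ^ h : ℂ) • ψ) j‖ ^ 2 = 16 ^ h * ‖ψ j‖ ^ 2 := by
      intro j
      simp [mul_pow, ← pow_mul, mul_comm h 2]
      simp [pow_mul]
      norm_num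
    rw [nsq, Finset.sum_congr rfl fun j _ => this j, ← Finset.mul_sum, ← nsq, hψ, mul_one]
  rw [h4] at hN
  push_cast at hN ⊢
  linear_combination -hN

end Svetlichny

section SwapIsometry

variable {n : Type*} [Fintype n] [DecidableEq n]

/-- The components of the local isometry extracting a qubit from two binary observables `X`, `Y`,
where the unitary `U` flips the extracted qubit. -/
def swapComp (U X Y : Matrix n n ℂ) (b : Fin 2) : Matrix n n ℂ :=
  (1 / 2 : ℂ) • (![1, U] b * ladder X Y b)

/-- The local isometry with components `swapComp`. -/
def swapIso (U X Y : Matrix n n ℂ) : Matrix (Fin 2 × n) n ℂ :=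
  Matrix.of fun p q => swapComp U X Y p.1 p.2 q

theorem swapIso_isometry {U X Y : Matrix n n ℂ} (hU : Uᴴ * U = 1) (hX : X.IsHermitian)
    (hY : Y.IsHermitian) (hX2 : X * X = 1) (hY2 : Y * Y = 1) :
    (swapIso U X Y)ᴴ * swapIso U X Y = 1 := by
  have hc : (swapIso U X Y)ᴴ * swapIso U X Y =
      ∑ b, (swapComp U X Y b)ᴴ * swapComp U X Y b := by
    ext i j
    simp only [Matrix.mul_apply, Matrix.sum_apply, Fintype.sum_prod_type]
    rfl
  have hb : ∀ b, (swapComp U X Y b)ᴴ * swapComp U X Y b =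
      (1 / 4 : ℂ) • (ladder X Y (1 - b) * ladder X Y b) := by
    intro b
    have hW : (![1, U] b)ᴴ * ![1, U] b = 1 := by
      fin_cases b <;> simp [hU]
    rw [swapComp, Matrix.conjTranspose_smul, Matrix.conjTranspose_mul, ladder_conjTranspose hX hY,
      smul_mul_assoc, mul_smul_comm, smul_smul, mul_assoc, ← mul_assoc _ _ (ladder X Y b), hW,
      one_mul]
    norm_num
  rw [hc, Fin.sum_univ_two, hb, hb, ← smul_add, add_comm]
  have := ladder_mul_add hX2 hY2
  simp only [sub_zero, sub_self]
  rw [this, smul_smul]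
  norm_num

end SwapIsometry

theorem ghzVec_snoc {h : ℕ} (p : Fin h → Fin 2) (b : Fin 2) :
    ghzVec (Fin.snoc p b : Fin (h + 1) → Fin 2) =
      ((if p = 0 ∧ b = 0 then 1 else 0) + (if p = 1 ∧ b = 1 then 1 else 0)) / (√2 : ℂ) := by
  have hc : ∀ c : Fin 2, (Fin.snoc p b : Fin (h + 1) → Fin 2) = (fun _ => c) ↔
      p = (fun _ => c) ∧ b = c := by
    intro c
    constructor
    · intro e
      exact ⟨funext fun i => by simpa using congrFun e i.castSucc,
        by simpa using congrFun e (Fin.last h)⟩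
    · rintro ⟨rfl, rfl⟩
      funext i
      refine Fin.lastCases ?_ (fun j => ?_) i <;> simp
  simp only [ghzVec, hc]
  rfl

theorem tens_swapComp_mulVec {h : ℕ} {d : Fin h → ℕ} {dD : ℕ}
    (A : (i : Fin h) → Fin 2 → Matrix (Fin (d i)) (Fin (d i)) ℂ)
    (U M0 M1 : Matrix (Fin dD) (Fin dD) ℂ) (p : Fin h → Fin 2) (b : Fin 2)
    (ψ : FullIdx h d dD → ℂ) :
    tens (fun i => swapComp (A i 0) (A i 0) (A i 1) (p i)) (swapComp U M0 M1 b) *ᵥ ψ =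
      (1 / 2 ^ (h + 1) : ℂ) • tens (fun i => ![1, A i 0] (p i)) (![1, U] b) *ᵥ
        honest dD A p *ᵥ tens (fun _ => 1) (ladder M0 M1 b) *ᵥ ψ := by
  simp only [swapComp]
  rw [tens_smul, Matrix.smul_mulVec, Matrix.mulVec_mulVec, Matrix.mulVec_mulVec, honest, tens_mul,
    tens_mul]
  simp only [mul_one]
  congr 1
  simp [pow_succ, mul_comm]

end Preliminaries

/-- Theorem 1 (self-testing of the GHZ state with dishonest parties, state part): with
`h = k - 1 ≥ 1` honest parties and dishonest input strings of length `N - k + 1 = s + 1`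
(so `N = h + (s+1)` and `2 ≤ k ≤ N`), any unit state maximally violating `Ŝ_N^+` is mapped,
by local isometries on the honest parties and a global isometry on the dishonest group, to
the `k`-partite GHZ state tensored with uncorrelated degrees of freedom. -/
theorem stmt_17 (h s : ℕ) (hh : 1 ≤ h) (d : Fin h → ℕ) (dD : ℕ)
    (A : (i : Fin h) → Fin 2 → Matrix (Fin (d i)) (Fin (d i)) ℂ)
    (M : (Fin (s + 1) → Fin 2) → Matrix (Fin dD) (Fin dD) ℂ)
    (hAherm : ∀ i b, (A i b).IsHermitian) (hAsq : ∀ i b, A i b * A i b = 1)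
    (hMherm : ∀ v, (M v).IsHermitian) (hMsq : ∀ v, M v * M v = 1)
    (ψ : FullIdx h d dD → ℂ) (hψ : (∑ p, ‖ψ p‖ ^ 2) = 1)
    (hmax : ∑ p, (starRingEnd ℂ) (ψ p) * (svetOp A M).mulVec ψ p =
      ((2 ^ (h + s) * Real.sqrt 2 : ℝ) : ℂ)) :
    ∃ (m : Fin h → ℕ) (mD : ℕ)
      (V : (i : Fin h) → Matrix (Fin 2 × Fin (m i)) (Fin (d i)) ℂ)
      (VD : Matrix (Fin 2 × Fin mD) (Fin dD) ℂ)
      (ζ : (((i : Fin h) → Fin (m i)) × Fin mD) → ℂ),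
      (∀ i, (V i)ᴴ * V i = 1) ∧ VDᴴ * VD = 1 ∧ (∑ a, ‖ζ a‖ ^ 2) = 1 ∧
        ∀ (f : (i : Fin h) → Fin 2 × Fin (m i)) (b : Fin 2) (a : Fin mD),
          (∑ x : FullIdx h d dD,
              (∏ i, V i (f i) (x.1 i)) * VD (b, a) x.2 * ψ x) =
            ghzVec (Fin.snoc (fun i => (f i).1) b) * ζ (fun i => (f i).2, a) := by
  have hI : Complex.I * Complex.I = -1 := Complex.I_mul_I
  have hmax' : star ψ ⬝ᵥ (svetOp A M *ᵥ ψ) = ((2 ^ (h + s) * √2 : ℝ) : ℂ) := hmax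
  obtain ⟨hdis, hmix⟩ := maximal_violation hh hAherm hAsq hMherm hMsq hψ hmax'
  set k : ℂ := ((√2 / 2 ^ h : ℝ) : ℂ) with hk
  set r : ℂ := (√2 : ℂ) with hr
  have hr2 : r ^ 2 = 2 := by
    rw [hr, ← Complex.ofReal_pow, Real.sq_sqrt (by norm_num)]
    norm_num
  have hr0 : r ≠ 0 := fun e => by simp [e] at hr2
  have hkr : k * 2 ^ h = r := by
    rw [hk, hr]
    push_cast
    field_simp
  have hk0 : k ≠ 0 := fun e => hr0 (by rw [← hkr, e, zero_mul])
  have hwt0 : wt (0 : Fin (s + 1) → Fin 2) = 0 := by simp [wt]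
  have hwt1 : wt (Pi.single 0 1 : Fin (s + 1) → Fin 2) = 1 := by
    rw [wt, Fin.sum_univ_succ]
    simp [Fin.succ_ne_zero]
  set v₁ : Fin (s + 1) → Fin 2 := Pi.single 0 1
  have hd0 := hdis 0
  have hd1 := hdis v₁
  rw [hwt0] at hd0
  rw [hwt1] at hd1
  set M₀ := M 0
  set M₁ := M v₁
  obtain ⟨hlower, hraise⟩ := dishonest_ladder_mulVec M₀ M₁ hd0 hd1
  have hsq := honest_sq_mulVec_eq_zero hh hAsq (hMsq 0) (hMsq v₁) hk0 hmix hlower hraise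
  have hnorm := nsq_ladder_mulVec hh hAherm hAsq hψ hmix hsq
  have hflip := tens_flip_mulVec hAsq hmix hsq
  set φ₀ := (honest dD A 0 * honest dD A 1) *ᵥ ψ with hφ₀
  set φ₁ := (honest dD A 1 * honest dD A 0) *ᵥ ψ with hφ₁
  set U : Matrix (Fin dD) (Fin dD) ℂ := ((1 + Complex.I) / r) • M₀ with hU
  have hUU : Uᴴ * U = 1 := by
    rw [hU, Matrix.conjTranspose_smul, (hMherm 0).eq, smul_mul_assoc, mul_smul_comm, smul_smul,
      hMsq]
    have : star ((1 + Complex.I) / r) * ((1 + Complex.I) / r) = 1 := by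
      simp only [hr, star_div₀, star_add, star_one, RCLike.star_def, Complex.conj_I,
        Complex.conj_ofReal]
      rw [← hr]
      field_simp
      linear_combination -hI - hr2
    rw [this, one_smul]
  have hA1 : ∀ i, (A i 0)ᴴ * A i 0 = 1 := fun i => by rw [(hAherm i 0).eq, hAsq]
  set W : Matrix (FullIdx h d dD) (FullIdx h d dD) ℂ := tens (fun i => A i 0) U with hW
  have hWW : Wᴴ * W = 1 := by
    rw [hW, tens_conjTranspose, tens_mul, hUU]
    simp only [hA1, tens_one]
  have hflip' : ((1 - Complex.I) * k) • W *ᵥ φ₁ = ((1 + Complex.I) * k) • φ₀ := by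
    have hW' : W = ((1 + Complex.I) / r) • (tens (fun i => A i 0) 1 * tens (fun _ => 1) M₀) := by
      rw [hW, hU, tens_smul_right, tens_mul]
      simp
    have hc : tens (fun _ => 1) M₀ *ᵥ φ₁ =
        (k * (1 + Complex.I) / 2) • honest dD A 1 *ᵥ φ₀ := by
      have hcomm : ∀ p, tens (fun _ => 1) M₀ * honest dD A p =
          honest dD A p * tens (fun _ => 1) M₀ :=
        fun p => (commute_tens_one _ M₀).eq.symm
      have hz : honest dD A 0 *ᵥ honest dD A 0 *ᵥ ψ = 0 := by rw [Matrix.mulVec_mulVec, hsq]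
      rw [hφ₁, Matrix.mulVec_mulVec, ← mul_assoc, hcomm, mul_assoc, hcomm, ← mul_assoc,
        ← Matrix.mulVec_mulVec, hd0, svetB, ← Matrix.mulVec_mulVec, Matrix.mulVec_smul,
        Matrix.add_mulVec, Matrix.smul_mulVec, Matrix.smul_mulVec, Matrix.mulVec_add,
        Matrix.mulVec_smul, Matrix.mulVec_smul, Matrix.mulVec_smul, hz, smul_zero, add_zero,
        Matrix.mulVec_smul, smul_smul, hφ₀, ← Matrix.mulVec_mulVec]
      congr 1
      ring
    rw [hW', Matrix.smul_mulVec, ← Matrix.mulVec_mulVec, hc, Matrix.mulVec_smul,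
      Matrix.mulVec_mulVec, hflip, smul_smul, smul_smul, smul_smul]
    congr 1
    field_simp
    linear_combination (1 - Complex.I) * (1 + Complex.I) ^ 2 * hkr - r * (1 + Complex.I) * hI
  set a := ((1 + Complex.I) * k) • φ₀ with ha
  have hlow : ∀ p, honest dD A p *ᵥ tens (fun _ => 1) (ladder M₀ M₁ 0) *ᵥ ψ =
      ((1 + Complex.I) * k) • (honest dD A p * honest dD A 1) *ᵥ ψ := fun p => by
    rw [hlower, Matrix.mulVec_smul, Matrix.mulVec_mulVec]
  have hrai : ∀ p, honest dD A p *ᵥ tens (fun _ => 1) (ladder M₀ M₁ 1) *ᵥ ψ =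
      ((1 - Complex.I) * k) • (honest dD A p * honest dD A 0) *ᵥ ψ := fun p => by
    rw [hraise, Matrix.mulVec_smul, Matrix.mulVec_mulVec]
  have h01 : (0 : Fin h → Fin 2) ≠ 1 := fun e => by simpa using congrFun e ⟨0, hh⟩
  have hcoef : (1 / 2 ^ (h + 1) : ℂ) = 1 / r * (r / 2 ^ (h + 1)) := by field_simp
  have hcomp : ∀ (p : Fin h → Fin 2) (b : Fin 2),
      tens (fun i => swapComp (A i 0) (A i 0) (A i 1) (p i)) (swapComp U M₀ M₁ b) *ᵥ ψ =
        ghzVec (Fin.snoc p b : Fin (h + 1) → Fin 2) • (r / 2 ^ (h + 1)) • a := by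
    intro p b
    rw [tens_swapComp_mulVec, ghzVec_snoc, ← hr]
    by_cases hp0 : p = 0
    · subst hp0
      rcases Fin.exists_fin_two.1 ⟨b, rfl⟩ with rfl | rfl
      · rw [hlow, ← hφ₀, ← ha]
        have h1 : tens (fun i => ![1, A i 0] ((0 : Fin h → Fin 2) i)) (![1, U] 0) =
            (1 : Matrix (FullIdx h d dD) (FullIdx h d dD) ℂ) := tens_one
        rw [h1, Matrix.one_mulVec, if_pos ⟨rfl, rfl⟩, if_neg fun e => h01 e.1, hcoef, add_zero,
          smul_smul (1 / r)]
      · rw [hrai, hsq]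
        simp [h01]
    by_cases hp1 : p = 1
    · subst hp1
      rcases Fin.exists_fin_two.1 ⟨b, rfl⟩ with rfl | rfl
      · rw [hlow, hsq]
        simp [h01.symm]
      · rw [hrai, ← hφ₁, Matrix.mulVec_smul]
        have h1 : tens (fun i => ![1, A i 0] ((1 : Fin h → Fin 2) i)) (![1, U] 1) = W := rfl
        rw [h1, hflip', if_neg fun e => h01 e.1.symm, if_pos ⟨rfl, rfl⟩, zero_add, hcoef,
          smul_smul (1 / r)]
    · rw [Matrix.mulVec_mulVec (M := honest dD A p), honest, (commute_tens_one _ _).eq, ← honest,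
        ← Matrix.mulVec_mulVec, hmix p hp0 hp1]
      simp [hp0, hp1]
  refine ⟨d, dD, fun i => swapIso (A i 0) (A i 0) (A i 1), swapIso U M₀ M₁, (r / 2 ^ (h + 1)) • a,
    fun i => swapIso_isometry (hA1 i) (hAherm i 0) (hAherm i 1) (hAsq i 0) (hAsq i 1),
    swapIso_isometry hUU (hMherm 0) (hMherm v₁) (hMsq 0) (hMsq v₁), ?_, fun f b c => ?_⟩
  · change nsq _ = 1
    have hadd : ‖1 + Complex.I‖ ^ 2 = 2 := by
      rw [← Complex.normSq_eq_norm_sq, Complex.normSq_apply]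
      norm_num
    have hsub : ‖1 - Complex.I‖ ^ 2 = 2 := by
      rw [← Complex.normSq_eq_norm_sq, Complex.normSq_apply]
      norm_num
    have hφ : nsq φ₁ = nsq φ₀ := by
      have e := congrArg nsq hflip'
      rw [← Matrix.mulVec_smul, nsq_mulVec_of_isometry hWW, ha, nsq_smul, nsq_smul] at e
      refine mul_left_cancel₀ ?_ (e.trans ?_)
      · simp [hk0, Complex.ext_iff]
      · rw [norm_mul, norm_mul, mul_pow, mul_pow, hadd, hsub]
    rw [hφ] at hnorm
    have hnr : ‖r‖ ^ 2 = 2 := by rw [← norm_pow, hr2]; norm_num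
    have hnk : ‖k‖ ^ 2 * 4 ^ h = 2 := by
      rw [← hnr, ← hkr, norm_mul, mul_pow, norm_pow, Complex.norm_ofNat, ← pow_mul, mul_comm h,
        pow_mul]
      norm_num
    have h16 : (16 : ℝ) ^ h = 4 ^ h * 4 ^ h := by rw [← mul_pow]; norm_num
    have h4 : ((2 : ℝ) ^ (h + 1)) ^ 2 = 4 * 4 ^ h := by
      rw [← pow_mul, mul_comm, pow_mul, pow_succ']
      norm_num
    rw [h16] at hnorm
    rw [nsq_smul, nsq_smul, norm_div, norm_mul, norm_pow, Complex.norm_ofNat, div_pow, mul_pow, hnr,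
      hadd, h4]
    field_simp
    linear_combination 2 * ‖k‖ ^ 2 * hnorm + 2 * 4 ^ h * hnk
  · exact congrFun (hcomp (fun i => (f i).1) b) (fun i => (f i).2, c)
end
end
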